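/- Let p be a prime, c ∈ [0,1], and let Θ(t) ∈ F_p((t^{-1})) be a quadratic irrational that exhibits c escape of mass with respect to the sequence {t^k}_{k≥0}. Then for any irreducible polynomial P(t) ∈ F_p[t], the Laurent series Θ(P(t)) ∈ F_p((t^{-1})) is a quadratic irrational that exhibits c escape of mass with respect to the sequence {P(t)^k}_{k≥0}. -/

import Mathlib

open scoped Classical
open Filter Polynomial

noncomputable section

namespace EscapeOfMass

variable {K : Type*} [Field K]

/-- The element `t` of `K((t⁻¹))`, modelled as the Laurent series field `K⸨X⸩`
in the variable `X = t⁻¹`; thus `t = X⁻¹ = single (-1) 1`. -/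
def tLS (K : Type*) [Field K] : LaurentSeries K := HahnSeries.single (-1 : ℤ) 1

/-- The polynomial part of a Laurent series in `K((t⁻¹))` (the terms with
non-negative powers of `t`, i.e. non-positive powers of `X`). -/
def polyPart (f : LaurentSeries K) : LaurentSeries K :=
  { coeff := fun n => if n ≤ 0 then f.coeff n else 0
    isPWO_support' := by
      refine f.isPWO_support'.mono fun n hn => ?_
      simp only [Function.mem_support, ne_eq] at hn ⊢
      intro h
      exact hn (by simp [h]) }

/-- The fractional part `⟨f⟩` of a Laurent series in `K((t⁻¹))`. -/
def fracPart (f : LaurentSeries K) : LaurentSeries K := f - polyPart f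

/-- The complete quotients of the continued fraction expansion of `f`. -/
def cfQuot (f : LaurentSeries K) : ℕ → LaurentSeries K
  | 0 => f
  | i + 1 => (cfQuot f i - polyPart (cfQuot f i))⁻¹

/-- The partial quotients `A_i` of the continued fraction expansion of `f`. -/
def cfPQ (f : LaurentSeries K) (i : ℕ) : LaurentSeries K := polyPart (cfQuot f i)

/-- The degree (as an integer) of a Laurent series viewed in `K((t⁻¹))`:
for a nonzero polynomial in `t` this is the usual degree. -/
def degZ (f : LaurentSeries K) : ℤ := -f.order

/-- `f` is a rational Laurent series, i.e. lies in `K(t)`. -/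
def IsRatLS (f : LaurentSeries K) : Prop := ∃ r : RatFunc K, (r : LaurentSeries K) = f

/-- `f` is a quadratic irrational: it is irrational and a root of a quadratic
polynomial with coefficients in `K[t]`. -/
def IsQuadIrr (f : LaurentSeries K) : Prop :=
  ¬ IsRatLS f ∧ ∃ a b c : Polynomial K, a ≠ 0 ∧
    Polynomial.aeval (tLS K) a * f ^ 2 + Polynomial.aeval (tLS K) b * f +
      Polynomial.aeval (tLS K) c = 0

/-- `(m, ℓ)` is a window for the periodic part of the continued fraction of `f`:
the partial quotients are periodic with period `ℓ ≥ 1` from index `m + 1` on. -/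
def PeriodWindow (f : LaurentSeries K) (m ℓ : ℕ) : Prop :=
  1 ≤ ℓ ∧ ∀ i : ℕ, m + 1 ≤ i → cfPQ f (i + ℓ) = cfPQ f i

/-- The `n`-escape of mass of the continued fraction expansion of `f`: the proportion,
within one period of the periodic part of the partial quotients of `f`, of the sum
`∑ max (deg A_i - n) 0` relative to `∑ deg A_i`. -/
def eMassOf (f : LaurentSeries K) (n : ℕ) : ℝ :=
  if h : ∃ s : ℕ × ℕ, PeriodWindow f s.1 s.2 then
    (∑ i ∈ Finset.Ico ((Classical.choose h).1 + 1)
        ((Classical.choose h).1 + 1 + (Classical.choose h).2),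
        max ((degZ (cfPQ f i) : ℝ) - n) 0) /
    (∑ i ∈ Finset.Ico ((Classical.choose h).1 + 1)
        ((Classical.choose h).1 + 1 + (Classical.choose h).2),
        (degZ (cfPQ f i) : ℝ))
  else 0

/-- The `n`-escape of mass in the `k`-th diagonal of `f` with respect to the
sequence `{g^k}`. -/
def eMassP (g f : LaurentSeries K) (k n : ℕ) : ℝ := eMassOf (g ^ k * f) n

/-- The `n`-escape of mass in the `k`-th diagonal of `f` with respect to `{t^k}`. -/
def eMass (f : LaurentSeries K) (k n : ℕ) : ℝ := eMassP (tLS K) f k n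

/-- `f` exhibits `c` escape of mass with respect to the sequence `{g^k}`. -/
def ExhibitsEscape (g f : LaurentSeries K) (c : ℝ) : Prop :=
  ∃ L : ℝ, Tendsto (fun n : ℕ => Filter.liminf (fun k : ℕ => eMassP g f k n) atTop)
    atTop (nhds L) ∧ c ≤ L

/-- `f` exhibits exactly `c` escape of mass with respect to the sequence `{g^k}`. -/
def ExhibitsExactEscape (g f : LaurentSeries K) (c : ℝ) : Prop :=
  Tendsto (fun n : ℕ => Filter.liminf (fun k : ℕ => eMassP g f k n) atTop)
    atTop (nhds c)

/-- `f` exhibits full (`c = 1`) maximal escape of mass with respect to `{g^k}`. -/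
def ExhibitsFullMaxEscape (g f : LaurentSeries K) : Prop :=
  Tendsto (fun n : ℕ => Filter.limsup (fun k : ℕ => eMassP g f k n) atTop)
    atTop (nhds 1)

/-- `A ⊆ ℕ` has natural density `c`. -/
def HasDensity (A : Set ℕ) (c : ℝ) : Prop :=
  Tendsto (fun M : ℕ => (((Finset.Icc 1 M).filter fun k => k ∈ A).card : ℝ) / M)
    atTop (nhds c)

/-- `f` exhibits full generic escape of mass with respect to `{t^k}`. -/
def FullGenericEscape (f : LaurentSeries K) : Prop :=
  ∀ ε : ℝ, 0 < ε → ∃ dens : ℕ → ℝ,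
    (∀ n : ℕ, HasDensity {k : ℕ | 1 - ε < eMass f k n} (dens n)) ∧
    Tendsto dens atTop (nhds 1)

/-- Substitution `t ↦ P(t)` on Laurent series: for `f = ∑_{i ≥ d} a_i t^{-i}` (with
`d = f.order` in the variable `X = t⁻¹`), `substLS f P = ∑_{i ≥ d} a_i P(t)^{-i}`. -/
def substLS (f : LaurentSeries K) (P : Polynomial K) : LaurentSeries K :=
  (Polynomial.aeval (tLS K) P)⁻¹ ^ f.order *
    HahnSeries.ofPowerSeries ℤ K
      (PowerSeries.mk fun n =>
        ∑ j ∈ Finset.range (n + 1),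
          f.coeff (f.order + j) * (((Polynomial.aeval (tLS K) P)⁻¹ ^ j).coeff (n : ℤ)))

/-- The `p`-Cantor sequence over `ZMod p`. -/
def cantor (p : ℕ) : ℕ → ZMod p
  | 0 => 1
  | (n + 1) =>
    if hp : 1 < p then
      if (n + 1) % p % 2 = 1 then 0
      else (((p - 1) / 2).choose (((n + 1) % p) / 2) : ZMod p) * cantor p ((n + 1) / p)
    else 0
  decreasing_by exact Nat.div_lt_self (Nat.succ_pos _) hp

/-- `Θ̃_p = ∑_{i ≥ 0} c_i^{(p)} t^{-i}`. -/
def cantorTilde (p : ℕ) : LaurentSeries (ZMod p) :=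
  HahnSeries.ofPowerSeries ℤ (ZMod p) (PowerSeries.mk fun i => cantor p i)

/-- `Θ_p = t⁻¹ ∑_{i ≥ 0} c_i^{(p)} t^{-i}`. -/
def cantorTheta (p : ℕ) : LaurentSeries (ZMod p) :=
  HahnSeries.single (1 : ℤ) 1 * cantorTilde p

/-- The Thue–Morse sequence over `ZMod 2`. -/
def thueMorse (n : ℕ) : ZMod 2 := ((Nat.digits 2 n).sum : ZMod 2)

/-- The Thue–Morse Laurent series `τ = ∑_{n ≥ 1} τ_n t^{-n}`. -/
def tmSeries : LaurentSeries (ZMod 2) :=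
  HahnSeries.ofPowerSeries ℤ (ZMod 2) (PowerSeries.mk fun n => thueMorse n)

/-- The extension of a one-sided sequence to `ℤ` by zero. -/
def extendSeq (S : ℕ → K) : ℤ → K := fun i => if 0 ≤ i then S i.toNat else 0

/-- The entry `W(S)[m, n]` of the number wall of the (doubly infinite) sequence `s`:
the determinant of the `(m+1) × (m+1)` Toeplitz matrix `(s_{n - i + j})`. -/
def wallEntry (s : ℤ → K) (m : ℕ) (n : ℤ) : K :=
  (Matrix.of fun i j : Fin (m + 1) => s (n - (i : ℕ) + (j : ℕ))).det

/-- The Laurent series `t⁻¹ ∑_{i ≥ 0} s_i t^{-i}` associated to a sequence. -/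
def seriesOf (S : ℕ → K) : LaurentSeries K :=
  HahnSeries.single (1 : ℤ) 1 * HahnSeries.ofPowerSeries ℤ K (PowerSeries.mk S)

/-- The coefficient sequence of `Θ = t⁻¹ ∑ s_i t^{-i}`, extended to `ℤ` by zero. -/
def coeffSeq (f : LaurentSeries K) : ℤ → K := fun i => if 0 ≤ i then f.coeff (i + 1) else 0

/-- The absolute value of a Laurent series in `F_q((t⁻¹))`: `|f| = q^{deg f}`. -/
def absLS {K : Type*} [Field K] [Fintype K] (f : LaurentSeries K) : ℝ :=
  if f = 0 then 0 else (Fintype.card K : ℝ) ^ (-f.order)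


lemma algMap_eq (r : K) : algebraMap K (LaurentSeries K) r = HahnSeries.C r := by
  rw [HahnSeries.algebraMap_apply', ← HahnSeries.ofPowerSeries_C]; rfl

lemma tLS_pow (n : ℕ) : tLS K ^ n = HahnSeries.single (-(n : ℤ)) 1 := by
  simp [tLS, HahnSeries.single_pow]

lemma coeff_aeval_t (a : K[X]) (m : ℤ) :
    (aeval (tLS K) a).coeff m = if m ≤ 0 then a.coeff (-m).toNat else 0 := by
  induction a using Polynomial.induction_on' with
  | add p q hp hq => 
    rw [map_add, HahnSeries.coeff_add, hp, hq]; split_ifs <;> simp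
  | monomial n r =>
    rw [aeval_monomial, tLS_pow, algMap_eq, HahnSeries.C_mul_eq_smul, HahnSeries.coeff_smul,
      HahnSeries.coeff_single, Polynomial.coeff_monomial]
    split_ifs <;> first | omega | simp

lemma aeval_t_inj {a : K[X]} (h : aeval (tLS K) a = 0) : a = 0 := by
  ext n
  have := coeff_aeval_t a (-(n : ℤ))
  rw [h] at this
  simpa using this.symm

lemma order_eq_of {f : LaurentSeries K} {m : ℤ} (h1 : f.coeff m ≠ 0)
    (h2 : ∀ i < m, f.coeff i = 0) : f.order = m := by
  have h0 : f ≠ 0 := by rintro rfl; simp at h1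
  apply le_antisymm (HahnSeries.order_le_of_coeff_ne_zero h1)
  rw [HahnSeries.le_order_iff_forall h0]
  exact h2

lemma order_aeval_t (a : K[X]) : (aeval (tLS K) a).order = -(a.natDegree : ℤ) := by
  by_cases h : a = 0
  · simp [h]
  apply order_eq_of
  · rw [coeff_aeval_t]; simpa using h
  · intro i hi
    rw [coeff_aeval_t, if_pos (by omega), Polynomial.coeff_eq_zero_of_natDegree_lt (by omega)]

lemma exists_ps {f : LaurentSeries K} (h : ∀ i < 0, f.coeff i = 0) :
    ∃ g : PowerSeries K, HahnSeries.ofPowerSeries ℤ K g = f := by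
  refine ⟨PowerSeries.mk fun n => f.coeff n, ?_⟩
  ext i
  rw [PowerSeries.coeff_coe]
  split_ifs with hi
  · rw [h i hi]
  · rw [PowerSeries.coeff_mk]; congr 1; omega

lemma order_ps {g : PowerSeries K} (h : PowerSeries.constantCoeff g ≠ 0) :
    (HahnSeries.ofPowerSeries ℤ K g).order = 0 := by
  apply order_eq_of
  · rw [PowerSeries.coeff_coe]; simpa using h
  · intro i hi; rw [PowerSeries.coeff_coe, if_pos hi]

lemma order_inv' (f : LaurentSeries K) : (f⁻¹).order = - f.order := by
  by_cases h : f = 0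
  · simp [h]
  have := HahnSeries.order_mul h (inv_ne_zero h)
  rw [mul_inv_cancel₀ h, HahnSeries.order_one] at this
  omega

lemma order_zpow' (f : LaurentSeries K) (hf : f ≠ 0) (n : ℤ) : (f ^ n).order = n * f.order := by
  have : ∀ k : ℕ, (f ^ k).order = k * f.order := by
    intro k; rw [HahnSeries.order_pow]; simp
  cases n with
  | ofNat k => simp [this k]
  | negSucc k =>
    rw [zpow_negSucc, order_inv', this, Int.negSucc_eq]; push_cast; ring

lemma single_zpow' (n : ℤ) : (HahnSeries.single n 1 : LaurentSeries K) = 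
    (HahnSeries.single (1 : ℤ) 1 : LaurentSeries K) ^ n := by
  rw [RatFunc.single_zpow]

lemma exists_phi (P : K[X]) (hd : 0 < P.natDegree) :
    ∃ φ : LaurentSeries K →+* LaurentSeries K, (∀ f, φ f = substLS f P) ∧
      (∀ f, (φ f).order = P.natDegree * f.order) ∧
      (∀ a : K[X], φ (aeval (tLS K) a) = aeval (tLS K) (a.comp P)) := by
  set Q := (aeval (tLS K) P)⁻¹ with hQ
  have hP0 : P ≠ 0 := by rintro rfl; simp at hd
  have hPt : aeval (tLS K) P ≠ 0 := fun h => hP0 (aeval_t_inj h)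
  have hQ0 : Q ≠ 0 := inv_ne_zero hPt
  have hQo : Q.order = P.natDegree := by rw [hQ, order_inv', order_aeval_t]; simp
  obtain ⟨g, hg⟩ := exists_ps (f := Q) (fun i hi =>
    HahnSeries.coeff_eq_zero_of_lt_order (by omega))
  have hg0 : PowerSeries.constantCoeff g = 0 := by
    have : Q.coeff ((0 : ℕ) : ℤ) = 0 := HahnSeries.coeff_eq_zero_of_lt_order (by simp; omega)
    rw [← hg, HahnSeries.ofPowerSeries_apply_coeff] at this
    simpa using this
  have hS : PowerSeries.HasSubst g := PowerSeries.HasSubst.of_constantCoeff_zero' hg0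
  have hcc : ∀ f : PowerSeries K, PowerSeries.constantCoeff (PowerSeries.subst g f) =
      PowerSeries.constantCoeff f := by
    intro f
    have : f = PowerSeries.C (PowerSeries.constantCoeff f) + 
      (PowerSeries.mk fun p => PowerSeries.coeff (p+1) f) * PowerSeries.X := by
      rw [add_comm]; exact PowerSeries.eq_shift_mul_X_add_const f
    conv_lhs => rw [this, PowerSeries.subst_add hS, PowerSeries.subst_mul hS, PowerSeries.subst_X hS]
    have hC : PowerSeries.subst g (PowerSeries.C (PowerSeries.constantCoeff f)) = PowerSeries.C (PowerSeries.constantCoeff f) := PowerSeries.subst_C _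
    rw [hC]
    simp [hg0]
  let ψ : PowerSeries K →+* LaurentSeries K :=
    (HahnSeries.ofPowerSeries ℤ K).comp (PowerSeries.substAlgHom (R := K) hS).toRingHom
  have hψ : ∀ f, ψ f = HahnSeries.ofPowerSeries ℤ K (PowerSeries.subst g f) := by
    intro f
    simp [ψ, PowerSeries.coe_substAlgHom]
  have hψX : ψ PowerSeries.X = Q := by rw [hψ, PowerSeries.subst_X hS, hg]
  have hinj : Function.Injective ψ := by
    rw [injective_iff_map_eq_zero]
    intro f hf
    by_contra hne
    have hdec := PowerSeries.X_pow_order_mul_divXPowOrder (f := f)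
    rw [← hdec, map_mul, map_pow, hψX] at hf
    rcases mul_eq_zero.1 hf with h | h
    · exact pow_ne_zero _ hQ0 h
    · rw [hψ] at h
      have h2 := HahnSeries.ofPowerSeries_injective (h.trans (map_zero _).symm)
      have h3 := hcc (PowerSeries.divXPowOrder f)
      rw [h2, map_zero] at h3
      exact hne (PowerSeries.constantCoeff_divXPowOrder_eq_zero_iff.1 h3.symm)
  let φ : LaurentSeries K →+* LaurentSeries K := IsFractionRing.lift hinj
  have hφ : ∀ f : PowerSeries K, φ (HahnSeries.ofPowerSeries ℤ K f) = ψ f := 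
    fun f => IsFractionRing.lift_algebraMap hinj f
  have hφX : φ (HahnSeries.single (1 : ℤ) 1) = Q := by
    rw [← HahnSeries.ofPowerSeries_X, hφ, hψX]
  have hφf : ∀ f : LaurentSeries K, φ f = Q ^ f.order * ψ f.powerSeriesPart := by
    intro f
    conv_lhs => rw [← LaurentSeries.single_order_mul_powerSeriesPart f]
    rw [map_mul, hφ, single_zpow', map_zpow₀, hφX]
  refine ⟨φ, ?_, ?_, ?_⟩
  · intro f
    rw [hφf, substLS, hψ]
    congr 2
    ext n
    rw [PowerSeries.coeff_subst' hS, PowerSeries.coeff_mk,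
      finsum_eq_sum_of_support_subset (s := Finset.range (n+1))]
    · apply Finset.sum_congr rfl
      intro j _
      rw [LaurentSeries.powerSeriesPart_coeff, smul_eq_mul, ← hQ, ← hg, ← map_pow, 
        HahnSeries.ofPowerSeries_apply_coeff]
    · intro j hj
      by_contra hjn
      apply hj
      have : PowerSeries.coeff n (g ^ j) = 0 := by
        apply PowerSeries.coeff_of_lt_order
        refine lt_of_lt_of_le ?_ (PowerSeries.le_order_pow_of_constantCoeff_eq_zero j hg0)
        simp at hjn
        exact_mod_cast hjn
      simp [this]
  · intro f
    by_cases hf : f = 0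
    · simp [hf]
    have h1 : PowerSeries.constantCoeff f.powerSeriesPart ≠ 0 := by
      rw [← PowerSeries.coeff_zero_eq_constantCoeff_apply, LaurentSeries.powerSeriesPart_coeff]
      simpa [HahnSeries.coeff_order_eq_zero] using hf
    have h2 : (ψ f.powerSeriesPart) ≠ 0 := by
      intro h
      rw [map_eq_zero_iff ψ hinj] at h
      simp [h] at h1
    rw [hφf, HahnSeries.order_mul (zpow_ne_zero _ hQ0) h2, order_zpow' _ hQ0, hψ, order_ps, hQo]
    · ring
    · rwa [hcc]
  · have hC : ∀ r : K, φ (algebraMap K _ r) = algebraMap K _ r := by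
      intro r
      rw [algMap_eq, ← HahnSeries.ofPowerSeries_C, hφ, hψ]
      congr 1
      exact PowerSeries.subst_C _
    have ht : φ (tLS K) = aeval (tLS K) P := by
      change φ (HahnSeries.single (-1 : ℤ) 1) = _
      rw [single_zpow', map_zpow₀, hφX, hQ]; simp
    intro a
    induction a using Polynomial.induction_on' with
    | add p q hp hq => simp [hp, hq]
    | monomial n r => 
      rw [Polynomial.monomial_comp, aeval_monomial, map_mul, map_pow, hC, ht]; simp

lemma coe_coe' (q : K[X]) : ((algebraMap K[X] (RatFunc K) q : RatFunc K) :
    LaurentSeries K) = HahnSeries.ofPowerSeries ℤ K (q : PowerSeries K) :=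
  (RatFunc.coe_coe q).symm

lemma coeff_polyPart (f : LaurentSeries K) (n : ℤ) :
    (polyPart f).coeff n = if n ≤ 0 then f.coeff n else 0 := rfl

lemma exists_poly (f : LaurentSeries K) : ∃ a : K[X], polyPart f = aeval (tLS K) a := by
  refine ⟨∑ n ∈ Finset.range (f.order.natAbs + 1), Polynomial.monomial n (f.coeff (-(n : ℤ))), ?_⟩
  ext m
  rw [coeff_aeval_t, coeff_polyPart]
  split_ifs with hm
  · rw [Polynomial.finsetSum_coeff]
    simp only [Polynomial.coeff_monomial, Finset.sum_ite_eq', Finset.mem_range]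
    split_ifs with h
    · congr 1; omega
    · exact HahnSeries.coeff_eq_zero_of_lt_order (by omega)
  · rfl

lemma polyPart_eq {f : LaurentSeries K} {a : K[X]}
    (h : ∀ i ≤ 0, (f - aeval (tLS K) a).coeff i = 0) : polyPart f = aeval (tLS K) a := by
  ext m
  rw [coeff_polyPart]
  split_ifs with hm
  · have := h m hm
    rw [HahnSeries.coeff_sub] at this
    exact sub_eq_zero.1 this
  · rw [coeff_aeval_t, if_neg hm]

lemma degZ_polyPart_nonneg (f : LaurentSeries K) : 0 ≤ degZ (polyPart f) := by
  obtain ⟨a, ha⟩ := exists_poly f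
  rw [degZ, ha, order_aeval_t]; simp

lemma map_polyPart (P : K[X]) (hd : 0 < P.natDegree) (φ : LaurentSeries K →+* LaurentSeries K)
    (ho : ∀ f, (φ f).order = P.natDegree * f.order)
    (hp : ∀ a : K[X], φ (aeval (tLS K) a) = aeval (tLS K) (a.comp P)) (f : LaurentSeries K) :
    φ (polyPart f) = polyPart (φ f) := by
  obtain ⟨a, ha⟩ := exists_poly f
  rw [ha, hp]
  symm
  apply polyPart_eq
  intro i hi
  rw [← hp, ← ha, ← map_sub]
  by_cases h0 : f - polyPart f = 0
  · simp [h0]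
  apply HahnSeries.coeff_eq_zero_of_lt_order
  rw [ho]
  have : 1 ≤ (f - polyPart f).order := by
    rw [HahnSeries.le_order_iff_forall h0]
    intro j hj
    rw [HahnSeries.coeff_sub, coeff_polyPart, if_pos (by omega), sub_self]
  have h2 : (1 : ℤ) ≤ P.natDegree := by omega
  nlinarith

lemma map_cfQuot (φ : LaurentSeries K →+* LaurentSeries K)
    (hφ : ∀ f, φ (polyPart f) = polyPart (φ f)) (f : LaurentSeries K) (i : ℕ) :
    cfQuot (φ f) i = φ (cfQuot f i) := by
  induction i with
  | zero => rfl
  | succ i ih => rw [cfQuot, cfQuot, ih, map_inv₀, map_sub, hφ]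

lemma map_cfPQ (φ : LaurentSeries K →+* LaurentSeries K)
    (hφ : ∀ f, φ (polyPart f) = polyPart (φ f)) (f : LaurentSeries K) (i : ℕ) :
    cfPQ (φ f) i = φ (cfPQ f i) := by
  rw [cfPQ, cfPQ, map_cfQuot φ hφ, hφ]

lemma cfQuot_succ' (f : LaurentSeries K) (i : ℕ) :
    cfQuot f (i + 1) = cfQuot ((f - polyPart f)⁻¹) i := by
  induction i with
  | zero => rfl
  | succ i ih => rw [cfQuot, ih, cfQuot]

lemma isRat_iff (f : LaurentSeries K) :
    IsRatLS f ↔ f ∈ IntermediateField.adjoin K {tLS K} := by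
  have hXt : (HahnSeries.single (1 : ℤ) 1 : LaurentSeries K) = (tLS K)⁻¹ := by
    rw [tLS, single_zpow' (-1)]; simp
  constructor
  · rintro ⟨r, rfl⟩
    have hpoly : ∀ q : K[X], ((algebraMap K[X] (RatFunc K) q : RatFunc K) : LaurentSeries K) ∈
        IntermediateField.adjoin K {tLS K} := by
      intro q
      have : ((algebraMap K[X] (RatFunc K) q : RatFunc K) : LaurentSeries K) =
          aeval (HahnSeries.single (1 : ℤ) 1 : LaurentSeries K) q := by
        induction q using Polynomial.induction_on' with
        | add p q hp hq => simp only [map_add, hp, hq]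
        | monomial n r =>
          rw [coe_coe', aeval_monomial, algMap_eq, Polynomial.coe_monomial,
            ← PowerSeries.coe_X, ← map_pow, ← HahnSeries.ofPowerSeries_C, ← map_mul,
            PowerSeries.monomial_eq_mk, PowerSeries.X_pow_eq]
          congr 1
          ext m
          simp [PowerSeries.coeff_monomial, PowerSeries.coeff_mk]
      rw [this, hXt]
      rw [Polynomial.aeval_eq_sum_range]
      refine sum_mem fun i _ => IntermediateField.smul_mem _ (pow_mem (inv_mem ?_) _)
      exact IntermediateField.mem_adjoin_simple_self K _
    rw [← RatFunc.num_div_denom r, map_div₀]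
    exact div_mem (hpoly _) (hpoly _)
  · intro h
    have ht : ((RatFunc.X⁻¹ : RatFunc K) : LaurentSeries K) = tLS K := by
      rw [map_inv₀, RatFunc.coe_X, hXt, inv_inv]
    have hC : ∀ r : K, ((RatFunc.C r : RatFunc K) : LaurentSeries K) = algebraMap K _ r := by
      intro r
      rw [← RatFunc.algebraMap_C, coe_coe', algMap_eq, ← HahnSeries.ofPowerSeries_C]
      simp
    induction h using IntermediateField.adjoin_induction with
    | mem x hx => rw [Set.mem_singleton_iff.1 hx]; exact ⟨_, ht⟩
    | algebraMap x => exact ⟨_, hC x⟩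
    | add x y _ _ hx hy => 
      obtain ⟨r, rfl⟩ := hx; obtain ⟨s, rfl⟩ := hy; exact ⟨r + s, map_add _ _ _⟩
    | mul x y _ _ hx hy => 
      obtain ⟨r, rfl⟩ := hx; obtain ⟨s, rfl⟩ := hy; exact ⟨r * s, map_mul _ _ _⟩
    | inv x _ hx => 
      obtain ⟨r, rfl⟩ := hx; exact ⟨r⁻¹, map_inv₀ _ _⟩

lemma aeval_t_mem (a : K[X]) : aeval (tLS K) a ∈ IntermediateField.adjoin K {tLS K} :=
  (IntermediateField.mem_adjoin_simple_iff K _).2 ⟨a, 1, by simp⟩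

lemma terminates (n : ℕ) : ∀ a b : K[X], b.natDegree ≤ n →
    ∃ i, cfQuot (aeval (tLS K) a / aeval (tLS K) b) i = 0 := by
  induction n using Nat.strong_induction_on with
  | _ n ih =>
    intro a b hb
    by_cases hb0 : b = 0
    · exact ⟨0, by simp [hb0, cfQuot]⟩
    have hbt : aeval (tLS K) b ≠ 0 := fun h => hb0 (aeval_t_inj h)
    have hsub : aeval (tLS K) a / aeval (tLS K) b - aeval (tLS K) (a / b) =
        aeval (tLS K) (a % b) / aeval (tLS K) b := by
      have := congrArg (aeval (tLS K)) (EuclideanDomain.div_add_mod a b)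
      rw [map_add, map_mul] at this
      rw [← this]
      field_simp
      ring
    have hdeg : a % b ≠ 0 → (a % b).natDegree < b.natDegree := fun h =>
      Polynomial.natDegree_lt_natDegree h (EuclideanDomain.mod_lt a hb0)
    have hpp : polyPart (aeval (tLS K) a / aeval (tLS K) b) = aeval (tLS K) (a / b) := by
      apply polyPart_eq
      intro i hi
      rw [hsub]
      by_cases h0 : a % b = 0
      · simp [h0]
      apply HahnSeries.coeff_eq_zero_of_lt_order
      have h1 : aeval (tLS K) (a % b) ≠ 0 := fun h => h0 (aeval_t_inj h)
      rw [div_eq_mul_inv, HahnSeries.order_mul h1 (inv_ne_zero hbt), order_inv', order_aeval_t,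
        order_aeval_t]
      have := hdeg h0
      omega
    by_cases h0 : a % b = 0
    · refine ⟨1, ?_⟩
      rw [cfQuot, cfQuot, hpp, hsub, h0]; simp
    · obtain ⟨i, hi⟩ := ih _ (lt_of_lt_of_le (hdeg h0) hb) b (a % b) le_rfl
      refine ⟨i + 1, ?_⟩
      rw [cfQuot_succ', hpp, hsub, inv_div, hi]

lemma isRat_iff_term (f : LaurentSeries K) : IsRatLS f ↔ ∃ i, cfQuot f i = 0 := by
  rw [isRat_iff]
  constructor
  · intro h
    obtain ⟨a, b, rfl⟩ := (IntermediateField.mem_adjoin_simple_iff K _).1 h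
    exact terminates _ a b le_rfl
  · rintro ⟨i, hi⟩
    have key : ∀ i, cfQuot f i ∈ IntermediateField.adjoin K {tLS K} →
        f ∈ IntermediateField.adjoin K {tLS K} := by
      intro i
      induction i with
      | zero => exact id
      | succ i ih =>
        intro h
        apply ih
        rw [cfQuot] at h
        have h := inv_mem h
        rw [inv_inv] at h
        obtain ⟨a, ha⟩ := exists_poly (cfQuot f i)
        rw [ha] at h
        have := add_mem h (aeval_t_mem a)
        rwa [sub_add_cancel] at this
    apply key i
    rw [hi]
    exact zero_mem _

lemma eMassOf_nonneg (f : LaurentSeries K) (n : ℕ) : 0 ≤ eMassOf f n := by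
  rw [eMassOf]
  split_ifs with h
  · apply div_nonneg
    · exact Finset.sum_nonneg fun i _ => le_max_right _ _
    · exact Finset.sum_nonneg fun i _ => by exact_mod_cast degZ_polyPart_nonneg _
  · rfl

lemma eMassOf_anti (f : LaurentSeries K) : Antitone (eMassOf f) := by
  intro m n hmn
  rw [eMassOf, eMassOf]
  split_ifs with h
  · apply div_le_div_of_nonneg_right
    · refine Finset.sum_le_sum fun i _ => max_le_max_right _ ?_
      have : (m : ℝ) ≤ n := by exact_mod_cast hmn
      linarith
    · exact Finset.sum_nonneg fun i _ => by exact_mod_cast degZ_polyPart_nonneg _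
  · rfl

lemma eMassOf_le_one (f : LaurentSeries K) (n : ℕ) : eMassOf f n ≤ 1 := by
  rw [eMassOf]
  split_ifs with h
  · apply div_le_one_of_le₀
    · refine Finset.sum_le_sum fun i _ => ?_
      have : (0 : ℝ) ≤ degZ (cfPQ f i) := by exact_mod_cast degZ_polyPart_nonneg _
      apply max_le _ this
      have : (0 : ℝ) ≤ n := by positivity
      linarith
    · exact Finset.sum_nonneg fun i _ => by exact_mod_cast degZ_polyPart_nonneg _
  · exact zero_le_one

lemma eMassOf_map (P : K[X]) (hd : 0 < P.natDegree) (φ : LaurentSeries K →+* LaurentSeries K)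
    (ho : ∀ f, (φ f).order = P.natDegree * f.order)
    (hφ : ∀ f, φ (polyPart f) = polyPart (φ f)) (f : LaurentSeries K) (n : ℕ) :
    eMassOf (φ f) (P.natDegree * n) = eMassOf f n := by
  have hw : PeriodWindow (φ f) = PeriodWindow f := by
    funext m l
    simp only [PeriodWindow, map_cfPQ φ hφ, φ.injective.eq_iff]
  have hdeg : ∀ i, (degZ (cfPQ (φ f) i) : ℝ) = P.natDegree * (degZ (cfPQ f i) : ℝ) := by
    intro i
    rw [map_cfPQ φ hφ, degZ, ho, degZ]; push_cast; ring
  have hd' : (0 : ℝ) < P.natDegree := by exact_mod_cast hd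
  have hmax : ∀ x : ℝ, max ((P.natDegree : ℝ) * x - (P.natDegree * n : ℕ)) 0 =
      P.natDegree * max (x - n) 0 := by
    intro x
    rw [mul_max_of_nonneg _ _ hd'.le]; push_cast; congr 1 <;> ring
  simp only [eMassOf, hw, hdeg, hmax, ← Finset.mul_sum]
  split_ifs with h
  · exact mul_div_mul_left _ _ hd'.ne'
  · rfl

lemma liminf_anti (g f : LaurentSeries K) :
    Antitone (fun n : ℕ => Filter.liminf (fun k : ℕ => eMassP g f k n) atTop) := by
  intro m n hmn
  apply Filter.liminf_le_liminf
  · exact Eventually.of_forall fun k => eMassOf_anti _ hmn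
  · exact isBoundedUnder_of ⟨0, fun k => eMassOf_nonneg _ _⟩
  · exact (isBoundedUnder_of ⟨1, fun k => eMassOf_le_one _ _⟩ : 
      IsBoundedUnder (· ≤ ·) atTop _).isCoboundedUnder_ge

lemma liminf_nonneg (g f : LaurentSeries K) (n : ℕ) :
    0 ≤ Filter.liminf (fun k : ℕ => eMassP g f k n) atTop := by
  apply Filter.le_liminf_of_le
  · exact (isBoundedUnder_of ⟨1, fun k => eMassOf_le_one _ _⟩ : 
      IsBoundedUnder (· ≤ ·) atTop _).isCoboundedUnder_ge
  · exact Eventually.of_forall fun k => eMassOf_nonneg _ _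

/-- Transference of `c` escape of mass from `{t^k}` to `{P(t)^k}`. -/
theorem escape_transference (p : ℕ) [Fact p.Prime] (c : ℝ) (hc : c ∈ Set.Icc (0 : ℝ) 1)
    (Θ : LaurentSeries (ZMod p)) (hΘ : IsQuadIrr Θ)
    (hesc : ExhibitsEscape (tLS (ZMod p)) Θ c)
    (P : Polynomial (ZMod p)) (hP : Irreducible P) :
    IsQuadIrr (substLS Θ P) ∧
      ExhibitsEscape (Polynomial.aeval (tLS (ZMod p)) P) (substLS Θ P) c := by
  have hd : 0 < P.natDegree := hP.natDegree_pos
  obtain ⟨φ, hs, ho, hp⟩ := exists_phi P hd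
  have hφ := map_polyPart P hd φ ho hp
  rw [← hs]
  refine ⟨⟨?_, ?_⟩, ?_⟩
  · rw [isRat_iff_term]
    rintro ⟨i, hi⟩
    rw [map_cfQuot φ hφ, map_eq_zero] at hi
    exact hΘ.1 ((isRat_iff_term Θ).2 ⟨i, hi⟩)
  · obtain ⟨a, b, e, ha, h⟩ := hΘ.2
    refine ⟨a.comp P, b.comp P, e.comp P, ?_, ?_⟩
    · intro h0
      have h1 := hp a
      rw [h0, map_zero, map_eq_zero] at h1
      exact ha (aeval_t_inj h1)
    · rw [← hp, ← hp, ← hp, ← map_pow, ← map_mul, ← map_mul, ← map_add, ← map_add, h, map_zero]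
  · obtain ⟨L, hL, hcL⟩ := hesc
    have ht : φ (tLS (ZMod p)) = aeval (tLS (ZMod p)) P := by
      have := hp X
      simpa using this
    have hsub : ∀ n, Filter.liminf (fun k : ℕ => eMassP (aeval (tLS (ZMod p)) P) (φ Θ) k
        (P.natDegree * n)) atTop = Filter.liminf (fun k : ℕ => eMassP (tLS (ZMod p)) Θ k n) atTop := by
      intro n
      congr 1
      funext k
      rw [eMassP, eMassP, ← ht, ← map_pow, ← map_mul, eMassOf_map P hd φ ho hφ]
    have hlim := tendsto_atTop_ciInf (liminf_anti (aeval (tLS (ZMod p)) P) (φ Θ))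
      ⟨0, by rintro _ ⟨n, rfl⟩; exact liminf_nonneg _ _ n⟩
    refine ⟨_, hlim, ?_⟩
    have hmul : Tendsto (fun n : ℕ => P.natDegree * n) atTop atTop :=
      tendsto_id.const_mul_atTop' hd
    have h2 := hlim.comp hmul
    have h3 := tendsto_nhds_unique (h2.congr hsub) hL
    rw [h3]
    exact hcL



end EscapeOfMass
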